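/- Let (E, {f_i}_{i=1}^m) ∈ 𝓔 with convex hull I. If f_1(I) ∩ f_2(I) = ∅, then dim_H (f_2(E) ∩ U_1(E)) = dim_H U_1(E). -/

import Mathlib

open Set Filter MeasureTheory

/-- A self-similar iterated function system on `ℝ` given by `m` similitudes
`f i x = r i * x + t i` (for `1 ≤ i ≤ m`, `m ≥ 3`), together with its attractor `E`:
the unique nonempty compact set with `E = ⋃_{i=1}^m f_i(E)`. -/
structure ClassE where
  m : ℕ
  r : ℕ → ℝ
  t : ℕ → ℝ
  E : Set ℝ
  hm : 3 ≤ m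
  hr : ∀ i, 1 ≤ i → i ≤ m → 0 < r i ∧ r i < 1
  hEne : E.Nonempty
  hEcpt : IsCompact E
  hEinv : E = ⋃ i ∈ Finset.Icc 1 m, (fun x => r i * x + t i) '' E

namespace ClassE

/-- The `i`-th similitude. -/
def f (S : ClassE) (i : ℕ) (x : ℝ) : ℝ := S.r i * x + S.t i

/-- Left endpoint `a` of the convex hull of `E`. -/
noncomputable def a (S : ClassE) : ℝ := sInf S.E

/-- Right endpoint `b` of the convex hull of `E`. -/
noncomputable def b (S : ClassE) : ℝ := sSup S.E

/-- The convex hull `I = [a, b]` of `E`. -/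
noncomputable def I (S : ClassE) : Set ℝ := Set.Icc S.a S.b

/-- Condition (A): `a = f_1(a) < f_2(a) < ⋯ < f_m(a) < f_m(b) = b`. -/
def condA (S : ClassE) : Prop :=
  S.f 1 S.a = S.a ∧ (∀ i, 1 ≤ i → i < S.m → S.f i S.a < S.f (i + 1) S.a) ∧
    S.f S.m S.a < S.f S.m S.b ∧ S.f S.m S.b = S.b

/-- Condition (B): `f_i(I) ∩ f_{i+2}(I) = ∅` for all `1 ≤ i ≤ m - 2`. -/
def condB (S : ClassE) : Prop :=
  ∀ i, 1 ≤ i → i + 2 ≤ S.m → S.f i '' S.I ∩ S.f (i + 2) '' S.I = ∅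

/-- Condition (C): there are `i, j ∈ {1, …, m-1}` with `f_i(I) ∩ f_{i+1}(I) = ∅` and
`f_j(I) ∩ f_{j+1}(I) ≠ ∅`. -/
def condC (S : ClassE) : Prop :=
  (∃ i, 1 ≤ i ∧ i + 1 ≤ S.m ∧ S.f i '' S.I ∩ S.f (i + 1) '' S.I = ∅) ∧
    (∃ j, 1 ≤ j ∧ j + 1 ≤ S.m ∧ S.f j '' S.I ∩ S.f (j + 1) '' S.I ≠ ∅)

/-- Condition (D): whenever `f_i(I) ∩ f_{i+1}(I) ≠ ∅` there are `u, v ≥ 1` with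
`f_i(I) ∩ f_{i+1}(I) = f_i ∘ f_m^u (I) = f_{i+1} ∘ f_1^v (I)`. -/
def condD (S : ClassE) : Prop :=
  ∀ i, 1 ≤ i → i + 1 ≤ S.m → S.f i '' S.I ∩ S.f (i + 1) '' S.I ≠ ∅ →
    ∃ u v : ℕ, 1 ≤ u ∧ 1 ≤ v ∧
      S.f i '' S.I ∩ S.f (i + 1) '' S.I = (S.f i ∘ (S.f S.m)^[u]) '' S.I ∧
      S.f i '' S.I ∩ S.f (i + 1) '' S.I = (S.f (i + 1) ∘ (S.f 1)^[v]) '' S.I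

/-- Membership in the class `𝓔`: conditions (A)–(D). -/
def goodE (S : ClassE) : Prop := S.condA ∧ S.condB ∧ S.condC ∧ S.condD

/-- `prefixMap d n = f_{d 0} ∘ f_{d 1} ∘ ⋯ ∘ f_{d (n-1)}`. -/
def prefixMap (S : ClassE) (d : ℕ → ℕ) : ℕ → ℝ → ℝ
  | 0 => id
  | n + 1 => S.prefixMap d n ∘ S.f (d n)

/-- `d : ℕ → ℕ` (with digits in `{1, …, m}`) is a coding of `x` if
`x = lim_n f_{d 0} ∘ ⋯ ∘ f_{d (n-1)} (0)`. -/
def isCoding (S : ClassE) (d : ℕ → ℕ) (x : ℝ) : Prop :=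
  (∀ n, 1 ≤ d n ∧ d n ≤ S.m) ∧
    Tendsto (fun n => S.prefixMap d n 0) atTop (nhds x)

/-- The set of codings of `x`. -/
def codings (S : ClassE) (x : ℝ) : Set (ℕ → ℕ) := {d | S.isCoding d x}

/-- `U k E`: the set of points of `E` having exactly `k` distinct codings
(`k` a cardinal; e.g. `k = ℵ₀` for countably infinitely many codings,
`k = 𝔠 = 2^ℵ₀` for a continuum of codings). -/
def U (S : ClassE) (k : Cardinal) : Set ℝ :=
  {x ∈ S.E | Cardinal.mk (S.codings x) = k}

end ClassE

open ClassE

namespace ClassE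

lemma aux_fE (S : ClassE) {i : ℕ} (h1 : 1 ≤ i) (h2 : i ≤ S.m) {x : ℝ} (hx : x ∈ S.E) :
    S.f i x ∈ S.E := by
  rw [S.hEinv]
  simp only [mem_iUnion]
  exact ⟨i, Finset.mem_Icc.2 ⟨h1, h2⟩, x, hx, rfl⟩

lemma aux_EI (S : ClassE) {x : ℝ} (hx : x ∈ S.E) : x ∈ S.I :=
  ⟨csInf_le S.hEcpt.bddBelow hx, le_csSup S.hEcpt.bddAbove hx⟩

lemma aux_aE (S : ClassE) : S.a ∈ S.E := S.hEcpt.sInf_mem S.hEne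
lemma aux_bE (S : ClassE) : S.b ∈ S.E := S.hEcpt.sSup_mem S.hEne

lemma aux_mono (S : ClassE) {i : ℕ} (h1 : 1 ≤ i) (h2 : i ≤ S.m) {x y : ℝ} (hx : x ≤ y) :
    S.f i x ≤ S.f i y := by
  have := mul_le_mul_of_nonneg_left hx (S.hr i h1 h2).1.le
  unfold f; linarith

lemma aux_fI (S : ClassE) {i : ℕ} (h1 : 1 ≤ i) (h2 : i ≤ S.m) {x : ℝ} (hx : x ∈ S.I) :
    S.f i x ∈ S.I :=
  ⟨(S.aux_EI (S.aux_fE h1 h2 S.aux_aE)).1.trans (S.aux_mono h1 h2 hx.1),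
    (S.aux_mono h1 h2 hx.2).trans (S.aux_EI (S.aux_fE h1 h2 S.aux_bE)).2⟩

lemma aux_inj (S : ClassE) {i : ℕ} (h1 : 1 ≤ i) (h2 : i ≤ S.m) {x y : ℝ}
    (h : S.f i x = S.f i y) : x = y := by
  have h0 := (S.hr i h1 h2).1
  unfold f at h
  exact mul_left_cancel₀ h0.ne' (by linarith)

lemma aux_rho (S : ClassE) : ∃ ρ : ℝ, 0 ≤ ρ ∧ ρ < 1 ∧ ∀ i, 1 ≤ i → i ≤ S.m → S.r i ≤ ρ := by
  have hm := S.hm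
  obtain ⟨k, hk, hmax⟩ := Finset.exists_max_image (Finset.Icc 1 S.m) S.r
    ⟨1, Finset.mem_Icc.2 ⟨le_rfl, by omega⟩⟩
  rw [Finset.mem_Icc] at hk
  exact ⟨S.r k, (S.hr k hk.1 hk.2).1.le, (S.hr k hk.1 hk.2).2,
    fun i h1 h2 => hmax i (Finset.mem_Icc.2 ⟨h1, h2⟩)⟩

lemma aux_dist (S : ClassE) {ρ : ℝ} (h0 : 0 ≤ ρ) (hρ : ∀ i, 1 ≤ i → i ≤ S.m → S.r i ≤ ρ)
    {d : ℕ → ℕ} (hd : ∀ n, 1 ≤ d n ∧ d n ≤ S.m) (n : ℕ) : ∀ x y : ℝ,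
    |S.prefixMap d n x - S.prefixMap d n y| ≤ ρ ^ n * |x - y| := by
  induction n with
  | zero => intro x y; simp [prefixMap]
  | succ n ih =>
    intro x y
    have h1 := ih (S.f (d n) x) (S.f (d n) y)
    have h2 : |S.f (d n) x - S.f (d n) y| ≤ ρ * |x - y| := by
      have : S.f (d n) x - S.f (d n) y = S.r (d n) * (x - y) := by unfold f; ring
      rw [this, abs_mul, abs_of_pos (S.hr _ (hd n).1 (hd n).2).1]
      exact mul_le_mul_of_nonneg_right (hρ _ (hd n).1 (hd n).2) (abs_nonneg _)
    calc _ ≤ _ := h1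
      _ ≤ ρ ^ n * (ρ * |x - y|) := mul_le_mul_of_nonneg_left h2 (pow_nonneg h0 n)
      _ = _ := by ring

lemma aux_prefI (S : ClassE) {d : ℕ → ℕ} (hd : ∀ n, 1 ≤ d n ∧ d n ≤ S.m) (n : ℕ) :
    ∀ x ∈ S.I, S.prefixMap d n x ∈ S.I := by
  induction n with
  | zero => intro x hx; simpa [prefixMap] using hx
  | succ n ih => intro x hx; exact ih _ (S.aux_fI (hd n).1 (hd n).2 hx)

lemma aux_codI (S : ClassE) {d : ℕ → ℕ} {x : ℝ} (h : S.isCoding d x) : x ∈ S.I := by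
  obtain ⟨hd, ht⟩ := h
  obtain ⟨ρ, h0, h1, hρ⟩ := S.aux_rho
  have hz : Tendsto (fun n => ρ ^ n * |S.a - 0|) atTop (nhds 0) := by
    simpa using (tendsto_pow_atTop_nhds_zero_of_lt_one h0 h1).mul_const |S.a - 0|
  have hdiff : Tendsto (fun n => S.prefixMap d n S.a - S.prefixMap d n 0) atTop (nhds 0) :=
    squeeze_zero_norm (fun n => S.aux_dist h0 hρ hd n S.a 0) hz
  have h3 : Tendsto (fun n => S.prefixMap d n S.a) atTop (nhds x) := by
    have := hdiff.add ht
    simpa using this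
  exact isClosed_Icc.mem_of_tendsto h3
    (Eventually.of_forall fun n => S.aux_prefI hd n _ (S.aux_EI S.aux_aE))

lemma aux_pref_succ (S : ClassE) (d : ℕ → ℕ) (n : ℕ) : ∀ x,
    S.prefixMap d (n + 1) x = S.f (d 0) (S.prefixMap (fun k => d (k + 1)) n x) := by
  induction n with
  | zero => intro x; simp [prefixMap]
  | succ n ih => intro x; exact ih (S.f (d (n + 1)) x)

def auxCons (i : ℕ) (d : ℕ → ℕ) : ℕ → ℕ
  | 0 => i
  | n + 1 => d n

lemma auxCons_inj (i : ℕ) : Function.Injective (auxCons i) := by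
  intro d e h
  funext n
  exact congrFun h (n + 1)

lemma aux_cons (S : ClassE) {i : ℕ} (h1 : 1 ≤ i) (h2 : i ≤ S.m) {d : ℕ → ℕ} {x : ℝ}
    (h : S.isCoding d x) : S.isCoding (auxCons i d) (S.f i x) := by
  refine ⟨fun n => ?_, ?_⟩
  · cases n with
    | zero => exact ⟨h1, h2⟩
    | succ n => exact h.1 n
  · rw [← tendsto_add_atTop_iff_nat 1]
    simp only [aux_pref_succ]
    exact (h.2.const_mul (S.r i)).add_const (S.t i)

lemma aux_tail (S : ClassE) {d : ℕ → ℕ} {y : ℝ} (h : S.isCoding d y) :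
    ∃ x, S.isCoding (fun n => d (n + 1)) x ∧ y = S.f (d 0) x := by
  have h0 := (S.hr _ (h.1 0).1 (h.1 0).2).1
  refine ⟨(y - S.t (d 0)) / S.r (d 0), ⟨fun n => h.1 _, ?_⟩, ?_⟩
  · have h3 := (tendsto_add_atTop_iff_nat 1).2 h.2
    simp only [aux_pref_succ] at h3
    have h4 := (h3.sub_const (S.t (d 0))).div_const (S.r (d 0))
    refine h4.congr fun n => ?_
    unfold f
    field_simp
    ring
  · unfold f; field_simp; ring

lemma aux_codings (S : ClassE) {i : ℕ} (h1 : 1 ≤ i) (h2 : i ≤ S.m) {x : ℝ}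
    (hx : ∀ j, 1 ≤ j → j ≤ S.m → j ≠ i → S.f i x ∉ S.f j '' S.I) :
    S.codings (S.f i x) = auxCons i '' S.codings x := by
  ext d
  constructor
  · intro hd
    obtain ⟨z, hz, he⟩ := S.aux_tail hd
    have h0 : d 0 = i := by
      by_contra hne
      exact hx _ (hd.1 0).1 (hd.1 0).2 hne ⟨z, S.aux_codI hz, he.symm⟩
    rw [h0] at he
    have := S.aux_inj h1 h2 he
    subst this
    refine ⟨_, hz, ?_⟩
    funext n
    cases n with
    | zero => exact h0.symm
    | succ n => rfl
  · rintro ⟨e, he, rfl⟩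
    exact S.aux_cons h1 h2 he

lemma aux_U (S : ClassE) {i : ℕ} (h1 : 1 ≤ i) (h2 : i ≤ S.m) {x : ℝ}
    (hx : ∀ j, 1 ≤ j → j ≤ S.m → j ≠ i → S.f i x ∉ S.f j '' S.I) (hU : x ∈ S.U 1) :
    S.f i x ∈ S.U 1 := by
  refine ⟨S.aux_fE h1 h2 hU.1, ?_⟩
  rw [S.aux_codings h1 h2 hx, Cardinal.mk_image_eq (auxCons_inj i)]
  exact hU.2

lemma aux_lt (S : ClassE) (hA : S.condA) {i j : ℕ} (h1 : 1 ≤ i) (hij : i ≤ j) (h2 : j ≤ S.m) :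
    S.f i S.a ≤ S.f j S.a := by
  induction j, hij using Nat.le_induction with
  | base => exact le_rfl
  | succ k hk ih => exact (ih (by omega)).trans (hA.2.1 k (by omega) (by omega)).le

/-- Disjointness propagates to the right. -/
lemma aux_disj (S : ClassE) (hA : S.condA) {i j k : ℕ} (h1 : 1 ≤ i) (hij : i ≤ j) (hjk : j ≤ k)
    (h2 : k ≤ S.m) (h : S.f i '' S.I ∩ S.f j '' S.I = ∅) {x y : ℝ} (hx : x ∈ S.I) (hy : y ∈ S.I) :
    S.f i x ≠ S.f k y := by
  have hab : S.a ≤ S.b := (S.aux_EI S.aux_aE).2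
  have hlt : S.f i S.b < S.f j S.a := by
    by_contra hle
    push Not at hle
    have h0 := (S.hr i h1 (by omega)).1
    have h3 := S.aux_lt hA h1 hij (by omega)
    have : S.f j S.a ∈ S.f i '' S.I ∩ S.f j '' S.I := by
      refine ⟨⟨(S.f j S.a - S.t i) / S.r i, ⟨?_, ?_⟩, ?_⟩, ⟨S.a, ⟨le_rfl, hab⟩, rfl⟩⟩
      · rw [le_div_iff₀ h0]; unfold f at h3 ⊢; linarith
      · rw [div_le_iff₀ h0]; unfold f at hle ⊢; linarith
      · change S.r i * _ + S.t i = _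
        field_simp; ring
    rw [h] at this
    exact this
  have h4 := S.aux_mono h1 (by omega : i ≤ S.m) hx.2
  have h5 := S.aux_mono (by omega : 1 ≤ k) h2 hy.1
  have h6 := S.aux_lt hA (by omega : 1 ≤ j) hjk h2
  intro he
  linarith

end ClassE

theorem stmt10 (S : ClassE) (hS : S.goodE)
    (h : S.f 1 '' S.I ∩ S.f 2 '' S.I = ∅) :
    dimH (S.f 2 '' S.E ∩ S.U 1) = dimH (S.U 1) := by
  obtain ⟨hA, hB, -, hD⟩ := hS
  have hm := S.hm
  have hab : S.a ≤ S.b := (S.aux_EI S.aux_aE).2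
  refine le_antisymm (dimH_mono inter_subset_right) ?_
  have h12 : ∀ k, 2 ≤ k → k ≤ S.m → ∀ x ∈ S.I, ∀ y ∈ S.I, S.f 1 x ≠ S.f k y :=
    fun k hk hkm x hx y hy => S.aux_disj hA le_rfl (by norm_num) hk hkm h hx hy
  have key : S.f 2 ∘ S.f 1 '' S.U 1 ⊆ S.f 2 '' S.E ∩ S.U 1 := by
    rintro _ ⟨x, hx, rfl⟩
    have hxI := S.aux_EI hx.1
    have hx1 : S.f 1 x ∈ S.U 1 := by
      refine S.aux_U le_rfl (by omega) ?_ hx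
      rintro j hj1 hj2 hne ⟨z, hz, he⟩
      exact h12 j (by omega) hj2 x hxI z hz he.symm
    refine ⟨⟨S.f 1 x, hx1.1, rfl⟩, ?_⟩
    have hx1I := S.aux_EI hx1.1
    refine S.aux_U (by norm_num) (by omega) ?_ hx1
    rintro j hj1 hj2 hne ⟨z, hz, he⟩
    rcases (by omega : j = 1 ∨ j = 3 ∨ 4 ≤ j) with rfl | rfl | hj
    · exact h12 2 le_rfl (by omega) z hz _ hx1I he
    · have hmem : S.f 2 (S.f 1 x) ∈ S.f 2 '' S.I ∩ S.f (2 + 1) '' S.I :=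
        ⟨⟨_, hx1I, rfl⟩, ⟨z, hz, he⟩⟩
      obtain ⟨u, v, hu, -, hu', -⟩ := hD 2 (by norm_num) (by omega)
        (nonempty_iff_ne_empty.1 ⟨_, hmem⟩)
      rw [hu'] at hmem
      obtain ⟨w, hw, hwe⟩ := hmem
      have hwe := S.aux_inj (by norm_num : 1 ≤ 2) (by omega) hwe
      obtain ⟨u, rfl⟩ : ∃ k, u = k + 1 := ⟨u - 1, by omega⟩
      rw [Function.iterate_succ_apply'] at hwe
      have hit : ∀ n, (S.f S.m)^[n] w ∈ S.I := by
        intro n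
        induction n with
        | zero => exact hw
        | succ n ih =>
          rw [Function.iterate_succ_apply']
          exact S.aux_fI (by omega) le_rfl ih
      exact h12 S.m (by omega) le_rfl x hxI _ (hit u) hwe.symm
    · exact S.aux_disj hA (by norm_num : 1 ≤ 2) (by norm_num : 2 ≤ 2 + 2) hj hj2
        (hB 2 (by norm_num) (by omega)) hx1I hz he.symm
  refine le_trans ?_ (dimH_mono key)
  have hr1 := (S.hr 1 le_rfl (by omega)).1
  have hr2 := (S.hr 2 (by norm_num) (by omega)).1
  have hanti : AntilipschitzWith (Real.toNNReal (S.r 2 * S.r 1)⁻¹) (S.f 2 ∘ S.f 1) := by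
    refine AntilipschitzWith.of_le_mul_dist fun x y => ?_
    have hp : 0 < S.r 2 * S.r 1 := mul_pos hr2 hr1
    rw [Real.coe_toNNReal _ (inv_pos.2 hp).le, Real.dist_eq, Real.dist_eq]
    have : (S.f 2 ∘ S.f 1) x - (S.f 2 ∘ S.f 1) y = (S.r 2 * S.r 1) * (x - y) := by
      simp only [Function.comp, f]; ring
    rw [this, abs_mul, abs_of_pos hp, inv_mul_cancel_left₀ hp.ne']
  exact hanti.le_dimH_image _
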